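/- arXiv:1402.0639 — 2 statements merged into one kernel-verified Lean document; each statement's English description precedes it below -/
import Mathlib

section
/- Let ν > −1 and let (α_{ν,n})_{n≥1} be the strictly increasing enumeration of the positive zeros of the Dini function d_ν. Then for every complex number z one has the Weierstrassian factorization d_ν(z) = (z^ν / (2^ν Γ(ν+1))) · ∏_{n≥1} (1 − z²/α_{ν,n}²), where the infinite product converges uniformly on each compact subset of the complex plane. -/
open Real Filter Set

/-- The Bessel function of the first kind of (real) order `ν`, for a complex argument,
defined by its power series (principal branch of `z ^ ν`). -/
noncomputable def besselJC (ν : ℝ) (z : ℂ) : ℂ :=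
  ∑' n : ℕ, (-1 : ℂ) ^ n * z ^ (2 * (n : ℂ) + (ν : ℂ)) /
    (2 ^ (2 * (n : ℂ) + (ν : ℂ)) * (n.factorial : ℂ) * Complex.Gamma ((n : ℂ) + ν + 1))

/-- The Dini function `d_ν(z) = (1-ν) J_ν(z) + z J_ν'(z) = J_ν(z) - z J_{ν+1}(z)`. -/
noncomputable def diniC (ν : ℝ) (z : ℂ) : ℂ :=
  besselJC ν z - z * besselJC (ν + 1) z

theorem exists_log_on_ball {g : ℂ → ℂ} {R : ℝ} (hR : 0 < R) (hg : Differentiable ℂ g)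
    (hne : ∀ z ∈ Metric.ball (0 : ℂ) R, g z ≠ 0) (h0 : g 0 = 1) :
    ∃ L : ℂ → ℂ, DifferentiableOn ℂ L (Metric.ball 0 R) ∧ L 0 = 0 ∧
      ∀ z ∈ Metric.ball (0 : ℂ) R, Complex.exp (L z) = g z := by
  have hd : DifferentiableOn ℂ (fun z => deriv g z / g z) (Metric.ball 0 R) :=
    (hg.deriv.differentiableOn).div hg.differentiableOn hne
  obtain ⟨L, hL0, hL⟩ := hd.isExactOn_ball.with_val_at 0 0
  refine ⟨L, fun z hz => (hL z hz).differentiableAt.differentiableWithinAt, hL0, ?_⟩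
  intro z hz
  have hmem : (0 : ℂ) ∈ Metric.ball (0 : ℂ) R := Metric.mem_ball_self hR
  have hder : ∀ w ∈ Metric.ball (0 : ℂ) R,
      HasDerivAt (fun w => g w * Complex.exp (-L w)) 0 w := by
    intro w hw
    have h1 := (hg w).hasDerivAt.mul ((hL w hw).neg.cexp)
    refine h1.congr_deriv ?_
    have := mul_div_cancel₀ (deriv g w) (hne w hw)
    rw [Pi.neg_apply]
    linear_combination (-Complex.exp (-L w)) * this
  have hc := Metric.isOpen_ball.is_const_of_deriv_eq_zero
    (convex_ball (0 : ℂ) R).isPreconnected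
    (fun w hw => (hder w hw).differentiableAt.differentiableWithinAt)
    (fun w hw => (hder w hw).deriv) hz hmem
  simp only [h0, hL0, neg_zero, Complex.exp_zero, mul_one, Complex.exp_neg] at hc
  field_simp at hc
  exact hc.symm

theorem tendsto_atTop_of_strictMono_zeros {f : ℂ → ℂ} (hf : Differentiable ℂ f) (h0 : f 0 ≠ 0)
    {β : ℕ → ℝ} (hβ : StrictMono β) (hz : ∀ n, f (β n) = 0) : Tendsto β atTop atTop := by
  rcases tendsto_atTop_of_monotone hβ.monotone with h | ⟨l, hl⟩
  · exact h
  exfalso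
  have hlt : ∀ n, β n < l := fun n =>
    (hβ (Nat.lt_succ_self n)).trans_le (hβ.monotone.ge_of_tendsto hl _)
  have ht : Tendsto (fun n => (β n : ℂ)) atTop (nhdsWithin (l : ℂ) {(l : ℂ)}ᶜ) := by
    refine tendsto_nhdsWithin_iff.2 ⟨(Complex.continuous_ofReal.tendsto l).comp hl, ?_⟩
    exact Eventually.of_forall fun n => by simpa using (hlt n).ne
  have hfr : ∃ᶠ z in nhdsWithin (l : ℂ) {(l : ℂ)}ᶜ, f z = 0 :=
    ht.frequently (Frequently.of_forall hz)
  have hA : AnalyticOnNhd ℂ f univ := fun z _ => hf.analyticAt z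
  have := hA.eqOn_zero_of_preconnected_of_frequently_eq_zero isPreconnected_univ (mem_univ _) hfr
  exact h0 (this (mem_univ 0))

theorem exists_div_partial_product {f : ℂ → ℂ} (hf : Differentiable ℂ f)
    {β : ℕ → ℝ} (hpos : ∀ n, 0 < β n) (hβ : StrictMono β)
    (hz : ∀ n, f (β n) = 0) (hz' : ∀ n, deriv f (β n) ≠ 0) (N : ℕ) :
    ∃ g : ℂ → ℂ, Differentiable ℂ g ∧
      (∀ w, f w = (∏ n ∈ Finset.range N, (1 - w / (β n : ℂ))) * g w) ∧
      ∀ w, g w = 0 → f w = 0 ∧ ∀ n < N, w ≠ β n := by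
  induction N with
  | zero => exact ⟨f, hf, by simp, by simp⟩
  | succ N ih =>
    obtain ⟨g, hg, hfg, hgz⟩ := ih
    have hb : (β N : ℂ) ≠ 0 := by exact_mod_cast (hpos N).ne'
    have hPN : (∏ n ∈ Finset.range N, (1 - (β N : ℂ) / (β n : ℂ))) ≠ 0 := by
      refine Finset.prod_ne_zero_iff.2 fun n hn => ?_
      have hbn : (β n : ℂ) ≠ 0 := by exact_mod_cast (hpos n).ne'
      rw [Finset.mem_range] at hn
      have hlt := (hβ hn).ne'
      intro h
      rw [sub_eq_zero, eq_div_iff hbn, one_mul] at h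
      exact hlt (by exact_mod_cast h.symm)
    have hgN : g (β N) = 0 := by
      have := hfg (β N)
      rw [hz N] at this
      exact (mul_eq_zero.1 this.symm).resolve_left hPN
    have hds : Differentiable ℂ (dslope g (β N)) := by
      rw [← differentiableOn_univ] at hg ⊢
      exact (Complex.differentiableOn_dslope univ_mem).2 hg
    have hgd : ∀ w, g w = (1 - w / (β N : ℂ)) * (-(β N : ℂ) * dslope g (β N) w) := by
      intro w
      have h1 := sub_smul_dslope g (β N : ℂ) w
      rw [hgN, sub_zero, smul_eq_mul] at h1
      rw [← h1]
      field_simp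
      ring
    refine ⟨fun w => -(β N : ℂ) * dslope g (β N) w, hds.const_mul _, ?_, ?_⟩
    · intro w
      rw [Finset.prod_range_succ, mul_assoc, ← hgd, hfg]
    · intro w hw
      beta_reduce at hw
      have hgw : g w = 0 := by rw [hgd, hw, mul_zero]
      refine ⟨(hgz w hgw).1, fun n hn => ?_⟩
      rcases Nat.lt_succ_iff_lt_or_eq.1 hn with h | rfl
      · exact (hgz w hgw).2 n h
      · rintro rfl
        rw [dslope_same, mul_eq_zero] at hw
        have hd0 := hw.resolve_left (neg_ne_zero.2 hb)
        apply hz' n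
        have hPd : Differentiable ℂ
            (fun w : ℂ => ∏ m ∈ Finset.range n, (1 - w / (β m : ℂ))) := by fun_prop
        rw [show f = fun w => (∏ m ∈ Finset.range n, (1 - w / (β m : ℂ))) * g w from funext hfg]
        have := ((hPd (β n)).hasDerivAt.mul (hg (β n)).hasDerivAt).deriv
        rw [hd0, hgN] at this
        exact this.trans (by simp)

theorem partial_product_bound {f : ℂ → ℂ} (hf : Differentiable ℂ f) (hf0 : f 0 = 1)
    {β : ℕ → ℝ} (hpos : ∀ n, 0 < β n) (hβ : StrictMono β)
    (hz : ∀ n, f (β n) = 0) (hz' : ∀ n, deriv f (β n) ≠ 0)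
    (hall : ∀ w, f w = 0 → ∃ n, w = β n) {C ε : ℝ} (hε : 0 < ε) (hC : 1 ≤ C)
    (hgrowth : ∀ w, ‖f w‖ ≤ C * Real.exp (ε * ‖w‖)) (N : ℕ) :
    ∃ L : ℂ → ℂ, ∀ w, ‖w‖ < β N →
      f w = (∏ n ∈ Finset.range N, (1 - w / (β n : ℂ))) * Complex.exp (L w) ∧
      ‖L w‖ ≤ 2 * (Real.log C + ε * (2 * β N)) * ‖w‖ / (β N - ‖w‖) := by
  obtain ⟨g, hg, hfg, hgz⟩ := exists_div_partial_product hf hpos hβ hz hz' N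
  have hR := hpos N
  have hg0 : g 0 = 1 := by simpa [hf0] using (hfg 0).symm
  have hgne : ∀ z ∈ Metric.ball (0 : ℂ) (β N), g z ≠ 0 := by
    intro z hzb h
    obtain ⟨h1, h2⟩ := hgz z h
    obtain ⟨n, rfl⟩ := hall z h1
    have hn : ¬ n < N := fun hn => h2 n hn rfl
    rw [mem_ball_zero_iff, Complex.norm_real, Real.norm_of_nonneg (hpos n).le] at hzb
    exact hn (hβ.lt_iff_lt.1 hzb)
  obtain ⟨L, hLd, hL0, hL⟩ := exists_log_on_ball hR hg hgne hg0
  have hsphere : ∀ z ∈ Metric.sphere (0 : ℂ) (2 * β N),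
      ‖g z‖ ≤ C * Real.exp (ε * (2 * β N)) := by
    intro z hzs
    rw [mem_sphere_zero_iff_norm] at hzs
    have hP : 1 ≤ ‖∏ n ∈ Finset.range N, (1 - z / (β n : ℂ))‖ := by
      rw [norm_prod]
      refine Finset.prod_induction _ (1 ≤ ·) (fun _ _ => one_le_mul_of_one_le_of_one_le)
        le_rfl fun n hn => ?_
      rw [Finset.mem_range] at hn
      have h2 : 2 ≤ ‖z / (β n : ℂ)‖ := by
        rw [norm_div, Complex.norm_real, Real.norm_of_nonneg (hpos n).le, hzs,
          le_div_iff₀ (hpos n)]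
        linarith [hβ hn]
      have h3 := norm_sub_norm_le (z / (β n : ℂ)) 1
      rw [norm_one, norm_sub_rev] at h3
      linarith
    have h1 := hgrowth z
    rw [hfg z, norm_mul, hzs] at h1
    exact (le_mul_of_one_le_left (norm_nonneg _) hP).trans h1
  have hball : ∀ z ∈ Metric.ball (0 : ℂ) (β N), ‖g z‖ ≤ C * Real.exp (ε * (2 * β N)) := by
    intro z hzb
    refine Complex.norm_le_of_forall_mem_frontier_norm_le (Metric.isBounded_ball (x := (0 : ℂ))
      (r := 2 * β N)) hg.diffContOnCl ?_ ?_
    · intro w hw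
      rw [frontier_ball _ (by positivity)] at hw
      exact hsphere w hw
    · exact subset_closure (Metric.ball_subset_ball (by linarith) hzb)
  have hM : 0 < Real.log C + ε * (2 * β N) := by
    have := Real.log_nonneg hC
    positivity
  refine ⟨L, fun w hw => ?_⟩
  have hwb : w ∈ Metric.ball (0 : ℂ) (β N) := mem_ball_zero_iff.2 hw
  refine ⟨by rw [hL w hwb, hfg], ?_⟩
  refine Complex.borelCaratheodory_zero hM hLd ?_ hR hwb hL0
  intro z hzb
  have h1 := hball z hzb
  rw [← hL z hzb, Complex.norm_exp] at h1
  have h2 : C * Real.exp (ε * (2 * β N)) = Real.exp (Real.log C + ε * (2 * β N)) := by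
    rw [Real.exp_add, Real.exp_log (by linarith)]
  rw [h2] at h1
  exact Real.exp_le_exp.1 h1

/-- Hadamard factorization in genus zero, for functions of minimal exponential type whose zeros
are simple and positive. -/
theorem tendstoUniformlyOn_partial_product {f : ℂ → ℂ} (hf : Differentiable ℂ f) (hf0 : f 0 = 1)
    {β : ℕ → ℝ} (hpos : ∀ n, 0 < β n) (hβ : StrictMono β)
    (hz : ∀ n, f (β n) = 0) (hz' : ∀ n, deriv f (β n) ≠ 0)
    (hall : ∀ w, f w = 0 → ∃ n, w = β n)
    (hgrowth : ∀ ε > 0, ∃ C, ∀ w, ‖f w‖ ≤ C * Real.exp (ε * ‖w‖)) {K : Set ℂ}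
    (hK : IsCompact K) :
    TendstoUniformlyOn (fun N w => ∏ n ∈ Finset.range N, (1 - w / (β n : ℂ))) f atTop K := by
  obtain ⟨ρ, hρ⟩ := hK.isBounded.exists_norm_le
  obtain ⟨B, hB⟩ := hK.exists_bound_of_continuousOn hf.continuous.continuousOn
  set r := max ρ 1 with hr
  set B' := max B 1
  have hr1 : 1 ≤ r := le_max_right _ _
  have hB1 : 1 ≤ B' := le_max_right _ _
  rw [Metric.tendstoUniformlyOn_iff]
  intro δ hδ
  set η := min 1 (δ / (4 * B')) with hη
  have hη0 : 0 < η := by positivity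
  set ε := η / (16 * r) with hε
  have hε0 : 0 < ε := by positivity
  obtain ⟨C₀, hC₀⟩ := hgrowth ε hε0
  set C := max C₀ 1
  have hC : ∀ w, ‖f w‖ ≤ C * Real.exp (ε * ‖w‖) := fun w =>
    (hC₀ w).trans (by gcongr; exact le_max_left _ _)
  have hC1 : 1 ≤ C := le_max_right _ _
  have htop := tendsto_atTop_of_strictMono_zeros hf (by simp [hf0]) hβ hz
  filter_upwards [htop.eventually_ge_atTop (2 * r),
    htop.eventually_ge_atTop (Real.log C / ε)] with N hN1 hN2 w hw
  obtain ⟨L, hL⟩ := partial_product_bound hf hf0 hpos hβ hz hz' hall hε0 hC1 hC N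
  have hwr : ‖w‖ ≤ r := (hρ w hw).trans (le_max_left _ _)
  obtain ⟨h1, h2⟩ := hL w (by linarith)
  have hlog : Real.log C ≤ ε * β N := by
    rwa [div_le_iff₀ hε0, mul_comm] at hN2
  have hlog0 := Real.log_nonneg hC1
  have hβN := hpos N
  have hLη : ‖L w‖ ≤ η * (3 / 4) := by
    refine h2.trans ?_
    rw [div_le_iff₀ (by linarith)]
    calc 2 * (Real.log C + ε * (2 * β N)) * ‖w‖ ≤ 2 * (ε * β N + ε * (2 * β N)) * r := by gcongr
      _ = η * (3 / 4) * (β N / 2) := by rw [hε]; field_simp; ring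
      _ ≤ η * (3 / 4) * (β N - ‖w‖) := by gcongr; linarith
  have hL1 : ‖-L w‖ ≤ 1 := by
    rw [norm_neg]; have : η ≤ 1 := min_le_left _ _
    linarith
  have h3 : ∏ n ∈ Finset.range N, (1 - w / (β n : ℂ)) = f w * Complex.exp (-L w) := by
    rw [h1, mul_assoc, ← Complex.exp_add, add_neg_cancel, Complex.exp_zero, mul_one]
  rw [h3, dist_comm, dist_eq_norm, show f w * Complex.exp (-L w) - f w =
    f w * (Complex.exp (-L w) - 1) by ring, norm_mul]
  have h4 := Complex.norm_exp_sub_one_le hL1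
  rw [norm_neg] at h4
  have hη2 : η ≤ δ / (4 * B') := min_le_right _ _
  have hfw : ‖f w‖ ≤ B' := (hB w hw).trans (le_max_left _ _)
  calc ‖f w‖ * ‖Complex.exp (-L w) - 1‖ ≤ B' * (2 * (δ / (4 * B') * (3 / 4))) := by
        gcongr
        exact h4.trans (by linarith)
    _ < δ := by field_simp; linarith

theorem summable_inv_of_tendsto_product {f : ℂ → ℂ} {β : ℕ → ℝ} (hpos : ∀ n, 0 < β n)
    (h : Tendsto (fun N => ∏ n ∈ Finset.range N, (1 - (-1 : ℂ) / (β n : ℂ))) atTop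
      (nhds (f (-1)))) : Summable (fun n => (β n)⁻¹) := by
  have hb := h.norm.bddAbove_range
  obtain ⟨B, hB⟩ := hb
  refine summable_of_sum_range_le (c := B) (fun n => (inv_pos.2 (hpos n)).le) fun N => ?_
  have h1 := hB (mem_range_self N)
  have h2 : ‖∏ n ∈ Finset.range N, (1 - (-1 : ℂ) / (β n : ℂ))‖ =
      ∏ n ∈ Finset.range N, (1 + (β n)⁻¹) := by
    rw [norm_prod]
    refine Finset.prod_congr rfl fun n _ => ?_
    rw [show (1 - (-1 : ℂ) / (β n : ℂ)) = ((1 + (β n)⁻¹ : ℝ) : ℂ) by push_cast; ring,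
      Complex.norm_real, Real.norm_of_nonneg]
    have := hpos n
    positivity
  simp only [h2] at h1
  refine le_trans ?_ h1
  have h3 : ∀ M, 1 + ∑ n ∈ Finset.range M, (β n)⁻¹ ≤ ∏ n ∈ Finset.range M, (1 + (β n)⁻¹) := by
    intro M
    induction M with
    | zero => simp
    | succ M ih =>
      rw [Finset.sum_range_succ, Finset.prod_range_succ]
      have h4 : 0 ≤ ∑ n ∈ Finset.range M, (β n)⁻¹ :=
        Finset.sum_nonneg fun n _ => (inv_pos.2 (hpos n)).le
      have h5 := inv_pos.2 (hpos M)
      nlinarith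
  linarith [h3 N]

theorem tprod_eq_of_tendsto {f : ℂ → ℂ} {β : ℕ → ℝ} (hpos : ∀ n, 0 < β n)
    (h : ∀ w, Tendsto (fun N => ∏ n ∈ Finset.range N, (1 - w / (β n : ℂ))) atTop
      (nhds (f w))) (w : ℂ) : ∏' n, (1 - w / (β n : ℂ)) = f w := by
  have hs := summable_inv_of_tendsto_product hpos (h (-1))
  have hm : Multipliable (fun n => 1 + -(w / (β n : ℂ))) := by
    refine multipliable_one_add_of_summable ?_
    refine (hs.mul_left ‖w‖).congr fun n => ?_
    rw [norm_neg, norm_div, Complex.norm_real, Real.norm_of_nonneg (hpos n).le, div_eq_mul_inv]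
  simp only [← sub_eq_add_neg] at hm
  exact tendsto_nhds_unique hm.hasProd.tendsto_prod_nat (h w)

/-- The real sequence `c` decays fast enough for `∑ c n * w ^ n` to be entire. -/
def IsEntireCoeff (c : ℕ → ℝ) : Prop :=
  ∀ r : ℝ, 0 ≤ r → Summable fun n => |c n| * r ^ n

/-- The sum of the power series with real coefficients `c`. -/
noncomputable def realCoeffSeries (c : ℕ → ℝ) (w : ℂ) : ℂ := ∑' n, (c n : ℂ) * w ^ n

namespace IsEntireCoeff

variable {c d : ℕ → ℝ}

theorem summable (hc : IsEntireCoeff c) (w : ℂ) : Summable fun n => (c n : ℂ) * w ^ n := by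
  refine Summable.of_norm ((hc ‖w‖ (norm_nonneg w)).congr fun n => ?_)
  rw [norm_mul, norm_pow, Complex.norm_real, Real.norm_eq_abs]

theorem of_le_three_pow_mul (hc : IsEntireCoeff c) (h : ∀ n, |d n| ≤ 3 ^ n * |c n|) :
    IsEntireCoeff d := by
  intro r hr
  refine Summable.of_nonneg_of_le (fun n => by positivity) (fun n => ?_)
    (hc (3 * r) (by positivity))
  calc |d n| * r ^ n ≤ (3 ^ n * |c n|) * r ^ n := by gcongr; exact h n
    _ = |c n| * (3 * r) ^ n := by rw [mul_pow]; ring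

theorem nat_cast_mul (hc : IsEntireCoeff c) : IsEntireCoeff fun n => n * c n := by
  refine hc.of_le_three_pow_mul fun n => ?_
  rw [abs_mul, Nat.abs_cast]
  gcongr
  exact_mod_cast (Nat.lt_pow_self (by norm_num)).le

theorem shift (hc : IsEntireCoeff c) : IsEntireCoeff fun n => c (n + 1) := by
  intro r hr
  have h := (summable_nat_add_iff 1).2 (hc (r + 1) (by positivity))
  refine Summable.of_nonneg_of_le (fun n => by positivity) (fun n => ?_) h
  gcongr
  calc r ^ n ≤ (r + 1) ^ n := by gcongr; linarith
    _ ≤ (r + 1) ^ (n + 1) := pow_le_pow_right₀ (by linarith) (by omega)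

theorem shift_nat_cast_mul (hc : IsEntireCoeff c) :
    IsEntireCoeff fun n => ((n : ℝ) + 1) * c (n + 1) := by
  simpa using hc.nat_cast_mul.shift

theorem hasDerivAt (hc : IsEntireCoeff c) (w : ℂ) :
    HasDerivAt (realCoeffSeries c) (realCoeffSeries (fun n => ((n : ℝ) + 1) * c (n + 1)) w) w := by
  set R : ℝ := ‖w‖ + 1
  have hR : 0 ≤ R := by positivity
  have hu : Summable fun n : ℕ => |c n| * (n * R ^ (n - 1)) := by
    rw [← summable_nat_add_iff 1]
    refine (hc.shift_nat_cast_mul R hR).congr fun n => ?_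
    rw [abs_mul, abs_of_nonneg (by positivity : (0 : ℝ) ≤ (n : ℝ) + 1)]
    push_cast
    ring
  have hmem : w ∈ Metric.ball (0 : ℂ) R := by
    rw [mem_ball_zero_iff]
    exact lt_add_one _
  have hbound : ∀ (n : ℕ) (y : ℂ), y ∈ Metric.ball (0 : ℂ) R →
      ‖(c n : ℂ) * (n * y ^ (n - 1))‖ ≤ |c n| * (n * R ^ (n - 1)) := by
    intro n y hy
    rw [mem_ball_zero_iff] at hy
    rw [norm_mul, norm_mul, norm_pow, Complex.norm_real, Real.norm_eq_abs, Complex.norm_natCast]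
    gcongr
  have h := hasDerivAt_tsum_of_isPreconnected (g := fun n y => (c n : ℂ) * y ^ n)
    hu Metric.isOpen_ball (convex_ball (0 : ℂ) R).isPreconnected
    (fun n y _ => (hasDerivAt_pow n y).const_mul (c n : ℂ)) hbound hmem (hc.summable w) hmem
  refine h.congr_deriv ?_
  have hs : Summable fun n : ℕ => (c n : ℂ) * (n * w ^ (n - 1)) :=
    Summable.of_norm_bounded hu fun n => hbound n w hmem
  rw [hs.tsum_eq_zero_add, realCoeffSeries]
  simp only [Nat.cast_zero, zero_mul, mul_zero, zero_add, Nat.add_sub_cancel]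
  refine tsum_congr fun n => ?_
  push_cast
  ring

theorem differentiable (hc : IsEntireCoeff c) : Differentiable ℂ (realCoeffSeries c) :=
  fun w => (hc.hasDerivAt w).differentiableAt

theorem nat_cast_mul_eq (hc : IsEntireCoeff c) (w : ℂ) :
    realCoeffSeries (fun n => n * c n) w =
      w * realCoeffSeries (fun n => ((n : ℝ) + 1) * c (n + 1)) w := by
  rw [realCoeffSeries, (hc.nat_cast_mul.summable w).tsum_eq_zero_add, realCoeffSeries,
    ← tsum_mul_left]
  simp only [Nat.cast_zero, zero_mul, Complex.ofReal_zero, zero_add]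
  refine tsum_congr fun n => ?_
  push_cast
  ring

end IsEntireCoeff

theorem realCoeffSeries_zero (c : ℕ → ℝ) : realCoeffSeries c 0 = c 0 := by
  rw [realCoeffSeries, tsum_eq_single 0 fun n hn => by simp [hn]]
  simp

/-- If `n! * c n` are the coefficients of an entire series, then `∑ c n * w ^ n` has at most
minimal exponential type. -/
theorem realCoeffSeries_growth {c : ℕ → ℝ} (hc : IsEntireCoeff fun n => n.factorial * c n)
    {ε : ℝ} (hε : 0 < ε) :
    ∃ C, ∀ w, ‖realCoeffSeries c w‖ ≤ C * Real.exp (ε * ‖w‖) := by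
  set a : ℕ → ℝ := fun n => |(n.factorial : ℝ) * c n| * (ε⁻¹) ^ n with ha
  have hsum : Summable a := hc ε⁻¹ (by positivity)
  have ha0 : ∀ n, 0 ≤ a n := fun n => by positivity
  refine ⟨∑' n, a n, fun w => ?_⟩
  have hterm : ∀ n, ‖(c n : ℂ) * w ^ n‖ ≤ (∑' n, a n) * ((ε * ‖w‖) ^ n / n.factorial) := by
    intro n
    have h1 : ‖(c n : ℂ) * w ^ n‖ = a n * ((ε * ‖w‖) ^ n / n.factorial) := by
      rw [norm_mul, norm_pow, Complex.norm_real, Real.norm_eq_abs, ha]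
      simp only [abs_mul, Nat.abs_cast, inv_pow, mul_pow]
      have := n.factorial_ne_zero
      field_simp
    rw [h1]
    gcongr
    exact hsum.le_tsum n fun m _ => ha0 m
  have hexp : HasSum (fun n : ℕ => (ε * ‖w‖) ^ n / n.factorial) (Real.exp (ε * ‖w‖)) := by
    rw [Real.exp_eq_exp_ℝ]
    exact NormedSpace.expSeries_div_hasSum_exp _
  exact tsum_of_norm_bounded (hexp.mul_left _) hterm

/-- Coefficients `(-1)^n Γ(ν+1) / (4^n n! Γ(n+ν+1))` of the normalized Bessel function. -/
noncomputable def besselCoeff (ν : ℝ) : ℕ → ℝ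
  | 0 => 1
  | n + 1 => -besselCoeff ν n / (4 * ((n : ℝ) + 1) * ((n : ℝ) + ν + 1))

section besselCoeff

variable {ν : ℝ}

theorem nat_add_nu_add_one_pos (hν : -1 < ν) (n : ℕ) : 0 < (n : ℝ) + ν + 1 := by
  have : (0 : ℝ) ≤ n := n.cast_nonneg
  linarith

theorem besselCoeff_succ_mul (hν : -1 < ν) (n : ℕ) :
    4 * ((n : ℝ) + 1) * ((n : ℝ) + ν + 1) * besselCoeff ν (n + 1) = -besselCoeff ν n := by
  have := nat_add_nu_add_one_pos hν n
  rw [besselCoeff]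
  field_simp

theorem besselCoeff_eq (hν : -1 < ν) (n : ℕ) :
    besselCoeff ν n =
      (-1) ^ n * Real.Gamma (ν + 1) / (4 ^ n * n.factorial * Real.Gamma ((n : ℝ) + ν + 1)) := by
  induction n with
  | zero =>
    have : Real.Gamma (ν + 1) ≠ 0 := (Real.Gamma_pos_of_pos (by linarith)).ne'
    simp [besselCoeff, this]
  | succ n ih =>
    have h := nat_add_nu_add_one_pos hν n
    have hG := (Real.Gamma_pos_of_pos h).ne'
    have h2 : (((n + 1 : ℕ) : ℝ) + ν + 1) = ((n : ℝ) + ν + 1) + 1 := by push_cast; ring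
    rw [besselCoeff, ih, h2, Real.Gamma_add_one h.ne', Nat.factorial_succ]
    push_cast
    have := n.factorial_ne_zero
    field_simp
    ring

theorem besselCoeff_ne_zero (hν : -1 < ν) (n : ℕ) : besselCoeff ν n ≠ 0 := by
  intro h
  induction n with
  | zero => simp [besselCoeff] at h
  | succ n ih =>
    have h2 := besselCoeff_succ_mul hν n
    rw [h, mul_zero] at h2
    exact ih (neg_eq_zero.1 h2.symm)

theorem besselCoeff_mul_neg_one_pow_nonneg (hν : -1 < ν) (n : ℕ) :
    0 ≤ besselCoeff ν n * (-1) ^ n := by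
  rw [besselCoeff_eq hν, mul_comm, ← mul_div_assoc, ← mul_assoc, ← pow_add, ← two_mul, pow_mul]
  have h1 := Real.Gamma_pos_of_pos (nat_add_nu_add_one_pos hν n)
  have h2 : 0 < Real.Gamma (ν + 1) := Real.Gamma_pos_of_pos (by linarith)
  rw [neg_one_sq, one_pow, one_mul]
  positivity

theorem isEntireCoeff_factorial_mul_besselCoeff (hν : -1 < ν) :
    IsEntireCoeff fun n => n.factorial * besselCoeff ν n := by
  intro r hr
  rcases hr.eq_or_lt with rfl | hr
  · refine summable_of_ne_finset_zero (s := {0}) fun n hn => ?_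
    simp only [Finset.mem_singleton] at hn
    simp [hn]
  refine summable_of_ratio_test_tendsto_lt_one (l := 0) one_pos ?_ ?_
  · refine Eventually.of_forall fun n => ?_
    have := besselCoeff_ne_zero hν n
    have := n.factorial_ne_zero
    positivity
  · have hlim : Tendsto (fun n : ℕ => r / 4 / ((n : ℝ) + (ν + 1))) atTop (nhds 0) :=
      Tendsto.div_atTop tendsto_const_nhds
        (tendsto_atTop_add_const_right _ _ tendsto_natCast_atTop_atTop)
    refine hlim.congr fun n => ?_
    have h1 := besselCoeff_ne_zero hν n
    have h2 := n.factorial_ne_zero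
    have h3 := nat_add_nu_add_one_pos hν n
    have h4 : (0 : ℝ) < 4 * ((n : ℝ) + 1) * ((n : ℝ) + ν + 1) := by positivity
    have hrec : besselCoeff ν (n + 1) =
        -besselCoeff ν n / (4 * ((n : ℝ) + 1) * ((n : ℝ) + ν + 1)) := rfl
    beta_reduce
    rw [hrec, Nat.factorial_succ]
    simp only [norm_mul, norm_pow, Real.norm_eq_abs, abs_abs, abs_mul, abs_div, abs_neg,
      Nat.abs_cast, abs_of_pos hr, abs_of_pos h4]
    have h5 := abs_ne_zero.2 h1
    push_cast
    rw [← add_assoc]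
    field_simp
    ring

theorem two_mul_add_one_le_three_pow (n : ℕ) : 2 * n + 1 ≤ 3 ^ n := by
  induction n with
  | zero => simp
  | succ n ih => rw [pow_succ]; omega

theorem isEntireCoeff_factorial_mul_diniCoeff (hν : -1 < ν) :
    IsEntireCoeff fun n => n.factorial * ((2 * (n : ℝ) + 1) * besselCoeff ν n) := by
  refine (isEntireCoeff_factorial_mul_besselCoeff hν).of_le_three_pow_mul fun n => ?_
  rw [mul_left_comm, abs_mul, abs_of_nonneg (by positivity : (0 : ℝ) ≤ 2 * (n : ℝ) + 1)]
  gcongr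
  exact_mod_cast two_mul_add_one_le_three_pow n

theorem isEntireCoeff_besselCoeff (hν : -1 < ν) : IsEntireCoeff (besselCoeff ν) := by
  refine (isEntireCoeff_factorial_mul_besselCoeff hν).of_le_three_pow_mul fun n => ?_
  rw [abs_mul, Nat.abs_cast, ← mul_assoc]
  refine le_mul_of_one_le_left (abs_nonneg _) ?_
  exact one_le_mul_of_one_le_of_one_le (one_le_pow₀ (by norm_num))
    (by exact_mod_cast n.factorial_pos)

end besselCoeff

/-- The entire function `j` with `J_ν(z) = (z/2)^ν / Γ(ν+1) * j(z²)`. -/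
noncomputable def besselEntire (ν : ℝ) : ℂ → ℂ := realCoeffSeries (besselCoeff ν)

/-- The derivative of `besselEntire`. -/
noncomputable def besselEntireDeriv (ν : ℝ) : ℂ → ℂ :=
  realCoeffSeries fun n => ((n : ℝ) + 1) * besselCoeff ν (n + 1)

/-- The Euler derivative `w * j'(w)` of `besselEntire`. -/
noncomputable def besselEuler (ν : ℝ) : ℂ → ℂ :=
  realCoeffSeries fun n => n * besselCoeff ν n

/-- The entire function `f` with `d_ν(z) = (z/2)^ν / Γ(ν+1) * f(z²)`. -/
noncomputable def diniEntire (ν : ℝ) : ℂ → ℂ :=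
  realCoeffSeries fun n => (2 * (n : ℝ) + 1) * besselCoeff ν n

section diniEntire

variable {ν : ℝ}

theorem hasDerivAt_besselEntire (hν : -1 < ν) (w : ℂ) :
    HasDerivAt (besselEntire ν) (besselEntireDeriv ν w) w :=
  (isEntireCoeff_besselCoeff hν).hasDerivAt w

theorem besselEuler_eq (hν : -1 < ν) (w : ℂ) :
    besselEuler ν w = w * besselEntireDeriv ν w :=
  (isEntireCoeff_besselCoeff hν).nat_cast_mul_eq w

/-- Bessel's differential equation for `besselEntire`. -/
theorem hasDerivAt_besselEuler (hν : -1 < ν) (w : ℂ) :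
    HasDerivAt (besselEuler ν) (-besselEntire ν w / 4 - ν * besselEntireDeriv ν w) w := by
  have hb := isEntireCoeff_besselCoeff hν
  refine (hb.nat_cast_mul.hasDerivAt w).congr_deriv ?_
  rw [besselEntire, besselEntireDeriv, realCoeffSeries, realCoeffSeries, realCoeffSeries,
    ← tsum_mul_left, ← tsum_neg, ← tsum_div_const,
    ← ((hb.summable w).neg.div_const 4).tsum_sub ((hb.shift_nat_cast_mul.summable w).mul_left _)]
  refine tsum_congr fun n => ?_
  have h : (4 * ((n : ℂ) + 1) * ((n : ℂ) + ν + 1) * (besselCoeff ν (n + 1) : ℂ)) =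
      -(besselCoeff ν n : ℂ) := by exact_mod_cast besselCoeff_succ_mul hν n
  push_cast
  linear_combination (w ^ n / 4) * h

theorem diniEntire_eq (hν : -1 < ν) (w : ℂ) :
    diniEntire ν w = besselEntire ν w + 2 * besselEuler ν w := by
  have hb := isEntireCoeff_besselCoeff hν
  rw [diniEntire, besselEntire, besselEuler, realCoeffSeries, realCoeffSeries, realCoeffSeries,
    ← tsum_mul_left, ← (hb.summable w).tsum_add ((hb.nat_cast_mul.summable w).mul_left _)]
  refine tsum_congr fun n => ?_
  push_cast
  ring

theorem hasDerivAt_diniEntire (hν : -1 < ν) (w : ℂ) :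
    HasDerivAt (diniEntire ν) (besselEntireDeriv ν w +
      2 * (-besselEntire ν w / 4 - ν * besselEntireDeriv ν w)) w := by
  rw [show diniEntire ν = fun w => besselEntire ν w + 2 * besselEuler ν w from
    funext (diniEntire_eq hν)]
  exact (hasDerivAt_besselEntire hν w).add ((hasDerivAt_besselEuler hν w).const_mul 2)

theorem differentiable_diniEntire (hν : -1 < ν) : Differentiable ℂ (diniEntire ν) :=
  fun w => (hasDerivAt_diniEntire hν w).differentiableAt

theorem besselEntire_zero (ν : ℝ) : besselEntire ν 0 = 1 := by
  rw [besselEntire, realCoeffSeries_zero, besselCoeff, Complex.ofReal_one]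

theorem diniEntire_zero (ν : ℝ) : diniEntire ν 0 = 1 := by
  rw [diniEntire, realCoeffSeries_zero]
  simp [besselCoeff]

theorem continuous_besselEntire (hν : -1 < ν) : Continuous (besselEntire ν) :=
  (isEntireCoeff_besselCoeff hν).differentiable.continuous

theorem continuous_besselEntireDeriv (hν : -1 < ν) : Continuous (besselEntireDeriv ν) :=
  (isEntireCoeff_besselCoeff hν).shift_nat_cast_mul.differentiable.continuous

/-- `diniEntire` has no zero on the nonpositive real axis. -/
theorem diniEntire_ne_zero_of_nonpos (hν : -1 < ν) {x : ℝ} (hx : x ≤ 0) :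
    diniEntire ν x ≠ 0 := by
  have hs : Summable fun n : ℕ => ((2 * (n : ℝ) + 1) * besselCoeff ν n) * x ^ n := by
    have := ((isEntireCoeff_besselCoeff hν).of_le_three_pow_mul
      (d := fun n => (2 * (n : ℝ) + 1) * besselCoeff ν n) fun n => ?_).summable x
    · exact_mod_cast this
    · rw [abs_mul, abs_of_nonneg (by positivity : (0 : ℝ) ≤ 2 * (n : ℝ) + 1)]
      gcongr
      exact_mod_cast two_mul_add_one_le_three_pow n
  have hpos : ∀ n : ℕ, 0 ≤ ((2 * (n : ℝ) + 1) * besselCoeff ν n) * x ^ n := by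
    intro n
    have h1 := besselCoeff_mul_neg_one_pow_nonneg hν n
    have h2 : 0 ≤ (-x) ^ n := pow_nonneg (by linarith) n
    have h3 : ((2 * (n : ℝ) + 1) * besselCoeff ν n) * x ^ n =
        (2 * (n : ℝ) + 1) * (besselCoeff ν n * (-1) ^ n) * (-x) ^ n := by
      rw [mul_assoc, mul_assoc, mul_assoc, ← mul_pow, neg_one_mul, neg_neg]
    rw [h3]
    positivity
  have h0 : 1 ≤ ∑' n : ℕ, ((2 * (n : ℝ) + 1) * besselCoeff ν n) * x ^ n := by
    have := hs.le_tsum 0 fun n _ => hpos n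
    simpa [besselCoeff] using this
  have heq : diniEntire ν x =
      ((∑' n : ℕ, ((2 * (n : ℝ) + 1) * besselCoeff ν n) * x ^ n : ℝ) : ℂ) := by
    rw [diniEntire, realCoeffSeries, Complex.ofReal_tsum]
    push_cast
    rfl
  rw [heq, Complex.ofReal_ne_zero]
  linarith

end diniEntire

theorem pos_of_hasDerivAt_nonneg {G φ : ℝ → ℝ} {T : ℝ} (hT : 0 < T) (hG : Continuous G)
    (hG0 : G 0 = 0) (hder : ∀ t, 0 < t → HasDerivAt G (φ t) t) (hφ : ∀ t, 0 < t → 0 ≤ φ t)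
    (hφ' : ∀ᶠ t in nhdsWithin 0 (Ioi 0), 0 < φ t) : 0 < G T := by
  obtain ⟨u, hu, hu'⟩ := mem_nhdsGT_iff_exists_Ioo_subset.1 hφ'
  have hu0 : (0 : ℝ) < u := hu
  set s := min u T
  have hs : 0 < s := lt_min hu0 hT
  have hmono : MonotoneOn G (Ici 0) :=
    monotoneOn_of_deriv_nonneg (convex_Ici 0) hG.continuousOn
      (fun t ht => by
        rw [interior_Ici] at ht
        exact (hder t ht).differentiableAt.differentiableWithinAt)
      (fun t ht => by
        rw [interior_Ici] at ht
        rw [(hder t ht).deriv]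
        exact hφ t ht)
  have hstrict : StrictMonoOn G (Icc 0 s) :=
    strictMonoOn_of_deriv_pos (convex_Icc 0 s) hG.continuousOn fun t ht => by
      rw [interior_Icc] at ht
      rw [(hder t ht.1).deriv]
      exact hu' ⟨ht.1, ht.2.trans_le (min_le_left _ _)⟩
  have h1 := hstrict (left_mem_Icc.2 hs.le) (right_mem_Icc.2 hs.le) hs
  have h2 := hmono (mem_Ici.2 hs.le) (mem_Ici.2 hT.le) (min_le_right u T)
  linarith

section zeros

variable {ν : ℝ}

/-- Derivative along the ray `t ↦ a t` of the Euler derivative. -/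
theorem hasDerivAt_besselEuler_ray (hν : -1 < ν) (a : ℂ) {t : ℝ} (ht : 0 < t) :
    HasDerivAt (fun t : ℝ => besselEuler ν (a * t))
      (-a * besselEntire ν (a * t) / 4 - ν * (besselEuler ν (a * t) / t)) t := by
  have h1 : HasDerivAt (fun t : ℝ => a * (t : ℂ)) a t := by
    simpa using (Complex.ofRealCLM.hasDerivAt (x := t)).const_mul a
  refine ((hasDerivAt_besselEuler hν (a * t)).comp t h1).congr_deriv ?_
  have : (t : ℂ) ≠ 0 := by exact_mod_cast ht.ne'
  rw [besselEuler_eq hν]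
  field_simp

/-- Derivative along the ray `t ↦ a t` of `besselEntire`. -/
theorem hasDerivAt_besselEntire_ray (hν : -1 < ν) (a : ℂ) {t : ℝ} (ht : 0 < t) :
    HasDerivAt (fun t : ℝ => besselEntire ν (a * t)) (besselEuler ν (a * t) / t) t := by
  have h1 : HasDerivAt (fun t : ℝ => a * (t : ℂ)) a t := by
    simpa using (Complex.ofRealCLM.hasDerivAt (x := t)).const_mul a
  refine ((hasDerivAt_besselEntire hν (a * t)).comp t h1).congr_deriv ?_
  have : (t : ℂ) ≠ 0 := by exact_mod_cast ht.ne'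
  rw [besselEuler_eq hν]
  field_simp

theorem eventually_besselEntire_ray_ne_zero (hν : -1 < ν) (a : ℂ) :
    ∀ᶠ t : ℝ in nhdsWithin 0 (Ioi 0), (besselEntire ν (a * t)).re ≠ 0 := by
  have hc : Continuous fun t : ℝ => (besselEntire ν (a * t)).re := by
    have := continuous_besselEntire hν
    fun_prop
  refine ((hc.tendsto 0).mono_left nhdsWithin_le_nhds).eventually_ne ?_
  simp [besselEntire_zero]

/-- The zeros of `diniEntire` are real. -/
theorem im_eq_zero_of_diniEntire_eq_zero (hν : -1 < ν) {a : ℂ} (ha : diniEntire ν a = 0) :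
    a.im = 0 := by
  by_contra him
  have hcj := continuous_besselEntire hν
  have hcd := continuous_besselEntireDeriv hν
  set W : ℝ → ℝ := fun t => -a.im * (t ^ (ν + 1) *
    (a * besselEntireDeriv ν (a * t) * (starRingEnd ℂ) (besselEntire ν (a * t))).im)
  have hWc : Continuous W := by
    have h1 : Continuous fun t : ℝ => t ^ (ν + 1) :=
      Real.continuous_rpow_const (by linarith)
    have h2 : Continuous fun t : ℝ =>
        (a * besselEntireDeriv ν (a * t) * (starRingEnd ℂ) (besselEntire ν (a * t))).im := by
      have := Complex.continuous_conj
      fun_prop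
    exact (h1.mul h2).const_mul _
  have hW0 : W 0 = 0 := by
    simp [W, Real.zero_rpow (by linarith : ν + 1 ≠ 0)]
  have hder : ∀ t : ℝ, 0 < t →
      HasDerivAt W (a.im ^ 2 / 4 * t ^ ν * Complex.normSq (besselEntire ν (a * t))) t := by
    intro t ht
    have hu := hasDerivAt_besselEuler_ray hν a ht
    have hv := hasDerivAt_besselEntire_ray hν a ht
    have him := Complex.imCLM.hasFDerivAt.comp_hasDerivAt t (hu.mul hv.star)
    have hall := ((Real.hasDerivAt_rpow_const (x := t) (p := ν) (Or.inl ht.ne')).mul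
      him).const_mul (-a.im)
    have hev : W =ᶠ[nhds t] fun t : ℝ => -a.im * (t ^ ν *
        (besselEuler ν (a * t) * star (besselEntire ν (a * t))).im) := by
      filter_upwards [lt_mem_nhds ht] with s hs
      simp only [W]
      rw [besselEuler_eq hν, Real.rpow_add hs, Real.rpow_one,
        show a * (s : ℂ) * besselEntireDeriv ν (a * s) * star (besselEntire ν (a * s)) =
          (s : ℂ) * (a * besselEntireDeriv ν (a * s) *
            (starRingEnd ℂ) (besselEntire ν (a * s))) by rw [starRingEnd_apply]; ring,
        Complex.im_ofReal_mul]
      ring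
    refine (hall.congr_of_eventuallyEq hev).congr_deriv ?_
    have hrp : t ^ (ν - 1) = t ^ ν / t := by rw [Real.rpow_sub ht, Real.rpow_one]
    rw [hrp]
    simp only [Complex.imCLM_apply, Complex.star_def, map_div₀, Complex.conj_ofReal,
      Function.comp_apply, Pi.mul_apply]
    generalize besselEuler ν (a * t) = u
    generalize besselEntire ν (a * t) = v
    simp only [Complex.add_im, Complex.mul_im, Complex.sub_im, Complex.sub_re,
      Complex.div_ofReal_im, Complex.div_ofReal_re, Complex.conj_re, Complex.conj_im,
      Complex.mul_re, Complex.neg_re, Complex.neg_im, Complex.ofReal_re, Complex.ofReal_im,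
      Complex.normSq_apply, Complex.div_ofNat_re, Complex.div_ofNat_im]
    field_simp
    ring
  have hpos := pos_of_hasDerivAt_nonneg (T := 1) one_pos hWc hW0 hder
    (fun t ht => by have := Complex.normSq_nonneg (besselEntire ν (a * t)); positivity) (by
      filter_upwards [eventually_besselEntire_ray_ne_zero hν a, self_mem_nhdsWithin] with t ht ht0
      rw [mem_Ioi] at ht0
      have : 0 < Complex.normSq (besselEntire ν (a * t)) :=
        Complex.normSq_pos.2 fun h => ht (by rw [h, Complex.zero_re])
      positivity)
  rw [diniEntire_eq hν, besselEuler_eq hν] at ha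
  have hval : a * besselEntireDeriv ν a = -(besselEntire ν a / 2) := by
    linear_combination ha / 2
  have : W 1 = 0 := by
    simp only [W, Complex.ofReal_one, mul_one, hval]
    rw [neg_mul (besselEntire ν a / 2), div_mul_eq_mul_div, Complex.mul_conj, Complex.neg_im, Complex.div_ofNat_im,
      Complex.ofReal_im]
    simp
  linarith

/-- The positive zeros of `diniEntire` are simple. -/
theorem deriv_diniEntire_ne_zero (hν : -1 < ν) {a : ℝ} (ha0 : 0 < a)
    (ha : diniEntire ν a = 0) : deriv (diniEntire ν) a ≠ 0 := by
  intro hd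
  have hcj := continuous_besselEntire hν
  have hcd := continuous_besselEntireDeriv hν
  set E : ℝ → ℝ := fun t => t ^ (ν + 1) * ((besselEntire ν t).re ^ 2 +
    4 * ν * (besselEntire ν t).re * (besselEntireDeriv ν t).re +
    4 * t * (besselEntireDeriv ν t).re ^ 2)
  have hEc : Continuous E := by
    have h1 : Continuous fun t : ℝ => t ^ (ν + 1) :=
      Real.continuous_rpow_const (by linarith)
    refine h1.mul ?_
    fun_prop
  have hE0 : E 0 = 0 := by
    simp [E, Real.zero_rpow (by linarith : ν + 1 ≠ 0)]
  have hre : ∀ s : ℝ, (besselEuler ν s).re = s * (besselEntireDeriv ν s).re := by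
    intro s
    rw [besselEuler_eq hν, Complex.re_ofReal_mul]
  have hder : ∀ t : ℝ, 0 < t → HasDerivAt E (t ^ ν * (besselEntire ν t).re ^ 2) t := by
    intro t ht
    have hu := (hasDerivAt_besselEuler hν t).real_of_complex
    have hv := (hasDerivAt_besselEntire hν t).real_of_complex
    have hall := (Real.hasDerivAt_rpow_const (x := t) (p := ν) (Or.inl ht.ne')).mul
      ((((hasDerivAt_id t).mul (hv.pow 2)).add ((hv.mul hu).const_mul (4 * ν))).add
        ((hu.pow 2).const_mul 4))
    have hev : E =ᶠ[nhds t] fun t : ℝ => t ^ ν * ((t * (besselEntire ν t).re ^ 2 +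
        4 * ν * ((besselEntire ν t).re * (besselEuler ν t).re)) +
        4 * (besselEuler ν t).re ^ 2) := by
      filter_upwards [lt_mem_nhds ht] with s hs
      simp only [E]
      rw [hre, Real.rpow_add hs, Real.rpow_one]
      ring
    refine (hall.congr_of_eventuallyEq hev).congr_deriv ?_
    have hrp : t ^ (ν - 1) = t ^ ν / t := by rw [Real.rpow_sub ht, Real.rpow_one]
    rw [hrp]
    simp only [Pi.add_apply, Pi.mul_apply, Pi.pow_apply, id, Complex.sub_re,
      Complex.re_ofReal_mul, Complex.div_ofNat_re, Complex.neg_re, hre]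
    field_simp
    push_cast
    ring
  have hpos := pos_of_hasDerivAt_nonneg ha0 hEc hE0 hder (fun t ht => by positivity) (by
      filter_upwards [eventually_besselEntire_ray_ne_zero hν 1, self_mem_nhdsWithin] with t ht ht0
      rw [mem_Ioi] at ht0
      rw [one_mul] at ht
      positivity)
  rw [(hasDerivAt_diniEntire hν a).deriv] at hd
  rw [diniEntire_eq hν] at ha
  have h1 := congrArg Complex.re ha
  have h2 := congrArg Complex.re hd
  simp only [Complex.add_re, Complex.mul_re, Complex.sub_re, Complex.re_ofNat, Complex.im_ofNat,
    zero_mul, sub_zero, Complex.div_ofNat_re, Complex.neg_re, Complex.ofReal_re,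
    Complex.ofReal_im, Complex.zero_re, hre] at h1 h2
  have h3 : E a = 0 := by
    simp only [E]
    have h4 : (besselEntire ν a).re = -(2 * (a * (besselEntireDeriv ν a).re)) := by linarith
    rw [h4] at h2 ⊢
    have h5 : (besselEntireDeriv ν a).re * (1 - 2 * ν + a) = 0 := by linear_combination h2
    linear_combination a ^ (ν + 1) * 4 * a * (besselEntireDeriv ν a).re * h5
  linarith

end zeros

section dini

variable {ν : ℝ}

theorem cpow_two_mul_nat_add (hν : -1 < ν) (z : ℂ) (n : ℕ) :
    z ^ (2 * (n : ℂ) + (ν : ℂ)) = z ^ (ν : ℂ) * (z ^ 2) ^ n := by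
  rcases eq_or_ne z 0 with rfl | hz
  · rcases eq_or_ne ν 0 with rfl | hν0
    · rcases eq_or_ne n 0 with rfl | hn
      · simp
      · simp [hn]
    · have h1 : (2 * (n : ℂ) + (ν : ℂ)) ≠ 0 := by
        have : (2 * (n : ℝ) + ν) ≠ 0 := by
          rcases Nat.eq_zero_or_pos n with rfl | hn
          · simpa using hν0
          · have : (1 : ℝ) ≤ n := by exact_mod_cast hn
            linarith
        exact_mod_cast this
      rw [Complex.zero_cpow h1, Complex.zero_cpow (by exact_mod_cast hν0), zero_mul]
  · rw [add_comm, Complex.cpow_add _ _ hz, ← pow_mul, ← Complex.cpow_natCast]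
    push_cast
    rfl

theorem besselJC_eq (hν : -1 < ν) (z : ℂ) :
    besselJC ν z = z ^ (ν : ℂ) / (2 ^ (ν : ℂ) * Complex.Gamma ((ν : ℂ) + 1)) *
      besselEntire ν (z ^ 2) := by
  rw [besselJC, besselEntire, realCoeffSeries, ← tsum_mul_left]
  refine tsum_congr fun n => ?_
  rw [cpow_two_mul_nat_add hν, cpow_two_mul_nat_add hν, besselCoeff_eq hν]
  have h1 : Real.Gamma (ν + 1) ≠ 0 := (Real.Gamma_pos_of_pos (by linarith)).ne'
  have h2 : Complex.Gamma ((ν : ℂ) + 1) = (Real.Gamma (ν + 1) : ℂ) := by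
    rw [← Complex.Gamma_ofReal]; push_cast; rfl
  have h3 : Complex.Gamma ((n : ℂ) + ν + 1) = (Real.Gamma ((n : ℝ) + ν + 1) : ℂ) := by
    rw [← Complex.Gamma_ofReal]; push_cast; rfl
  have h4 : (Real.Gamma (ν + 1) : ℂ) ≠ 0 := by exact_mod_cast h1
  have h5 : (Real.Gamma ((n : ℝ) + ν + 1) : ℂ) ≠ 0 := by
    exact_mod_cast (Real.Gamma_pos_of_pos (nat_add_nu_add_one_pos hν n)).ne'
  have h6 : (2 : ℂ) ^ (ν : ℂ) ≠ 0 := by simp [Complex.cpow_eq_zero_iff]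
  have h7 : (n.factorial : ℂ) ≠ 0 := by exact_mod_cast n.factorial_ne_zero
  rw [h2, h3]
  push_cast
  rw [show (2 : ℂ) ^ 2 = 4 by norm_num]
  field_simp

theorem besselCoeff_add_one (hν : -1 < ν) (n : ℕ) :
    besselCoeff (ν + 1) n = -(4 * (ν + 1) * (((n : ℝ) + 1) * besselCoeff ν (n + 1))) := by
  have h := nat_add_nu_add_one_pos hν
  induction n with
  | zero =>
    have := h 0
    simp only [besselCoeff, Nat.cast_zero, zero_add] at this ⊢
    field_simp
  | succ n ih =>
    have h1 := h (n + 1)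
    have e1 := besselCoeff_succ_mul hν (n + 1)
    have e2 := besselCoeff_succ_mul (ν := ν + 1) (by linarith) n
    push_cast at *
    rw [ih] at e2
    have h3 : (4 * ((n : ℝ) + 1) * ((n : ℝ) + (ν + 1) + 1)) ≠ 0 := by
      have : 0 < (n : ℝ) + (ν + 1) + 1 := by linarith
      positivity
    refine mul_left_cancel₀ h3 ?_
    rw [e2]
    linear_combination (4 * (ν + 1) * ((n : ℝ) + 1)) * e1

theorem diniC_eq (hν : -1 < ν) (z : ℂ) :
    diniC ν z = z ^ (ν : ℂ) / (2 ^ (ν : ℂ) * Complex.Gamma ((ν : ℂ) + 1)) *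
      diniEntire ν (z ^ 2) := by
  have hder : besselEntire (ν + 1) (z ^ 2) = -(4 * (ν + 1)) * besselEntireDeriv ν (z ^ 2) := by
    rw [besselEntire, besselEntireDeriv, realCoeffSeries, realCoeffSeries, ← tsum_mul_left]
    refine tsum_congr fun n => ?_
    rw [besselCoeff_add_one hν]
    push_cast
    ring
  have hz : z * z ^ ((ν : ℂ) + 1) = z ^ (ν : ℂ) * z ^ 2 := by
    rcases eq_or_ne z 0 with rfl | hz
    · simp
    · rw [Complex.cpow_add _ _ hz, Complex.cpow_one]
      ring
  have hν1 : ((ν : ℂ) + 1) ≠ 0 := by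
    have : ν + 1 ≠ 0 := by linarith
    exact_mod_cast this
  have h6 : (2 : ℂ) ^ (ν : ℂ) ≠ 0 := by simp [Complex.cpow_eq_zero_iff]
  have hG : Complex.Gamma ((ν : ℂ) + 1) ≠ 0 := by
    refine Complex.Gamma_ne_zero_of_re_pos ?_
    simp
    linarith
  rw [diniC, besselJC_eq hν, besselJC_eq (by linarith), hder, diniEntire_eq hν,
    besselEuler_eq hν]
  push_cast
  rw [Complex.Gamma_add_one _ hν1, Complex.cpow_add _ _ two_ne_zero, Complex.cpow_one]
  have : z * (z ^ ((ν : ℂ) + 1) / (2 ^ (ν : ℂ) * 2 * (((ν : ℂ) + 1) *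
      Complex.Gamma ((ν : ℂ) + 1))) * (-(4 * ((ν : ℂ) + 1)) * besselEntireDeriv ν (z ^ 2))) =
      (z * z ^ ((ν : ℂ) + 1)) / (2 ^ (ν : ℂ) * Complex.Gamma ((ν : ℂ) + 1)) *
        (-2 * besselEntireDeriv ν (z ^ 2)) := by
    field_simp
    ring
  rw [this, hz]
  ring

theorem diniC_ofReal_eq_zero_iff (hν : -1 < ν) {x : ℝ} (hx : 0 < x) :
    diniC ν x = 0 ↔ diniEntire ν ((x ^ 2 : ℝ) : ℂ) = 0 := by
  have hG : Complex.Gamma ((ν : ℂ) + 1) ≠ 0 := by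
    refine Complex.Gamma_ne_zero_of_re_pos ?_
    simp
    linarith
  have hx' : (x : ℂ) ^ (ν : ℂ) ≠ 0 := by simp [Complex.cpow_eq_zero_iff, hx.ne']
  have h2 : (2 : ℂ) ^ (ν : ℂ) ≠ 0 := by simp [Complex.cpow_eq_zero_iff]
  rw [diniC_eq hν]
  simp [hx', h2, hG]

end dini

/-- Let `ν > -1` and let `α 1 < α 2 < ⋯` be the strictly increasing
enumeration of the positive zeros of the Dini function `d_ν` (with `α 0 = 0`). Then for
every complex `z`,
`d_ν(z) = z^ν / (2^ν Γ(ν+1)) * ∏_{n ≥ 1} (1 - z² / α_n²)`,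
and the infinite product converges uniformly on every compact subset of `ℂ`. -/
theorem dini_weierstrass_factorization (ν : ℝ) (hν : -1 < ν) (α : ℕ → ℝ)
    (hα0 : α 0 = 0) (hmono : StrictMono α)
    (hzeros : ∀ x : ℝ, (0 < x ∧ diniC ν (x : ℂ) = 0) ↔ ∃ n, 1 ≤ n ∧ α n = x) :
    (∀ z : ℂ, diniC ν z =
      z ^ (ν : ℂ) / (2 ^ (ν : ℂ) * Complex.Gamma ((ν : ℂ) + 1)) *
        ∏' n : ℕ, (1 - z ^ 2 / ((α (n + 1) : ℂ)) ^ 2)) ∧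
    (∀ K : Set ℂ, IsCompact K →
      TendstoUniformlyOn
        (fun (N : ℕ) (z : ℂ) => ∏ n ∈ Finset.range N, (1 - z ^ 2 / ((α (n + 1) : ℂ)) ^ 2))
        (fun z => ∏' n : ℕ, (1 - z ^ 2 / ((α (n + 1) : ℂ)) ^ 2)) atTop K) := by
  set β : ℕ → ℝ := fun n => α (n + 1) ^ 2 with hβdef
  have hαpos : ∀ n, 0 < α (n + 1) := fun n => hα0 ▸ hmono (Nat.succ_pos n)
  have hpos : ∀ n, 0 < β n := fun n => pow_pos (hαpos n) 2
  have hβ : StrictMono β := fun m n hmn =>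
    pow_lt_pow_left₀ (hmono (Nat.succ_lt_succ hmn)) (hαpos m).le two_ne_zero
  have hz : ∀ n, diniEntire ν (β n) = 0 := fun n =>
    (diniC_ofReal_eq_zero_iff hν (hαpos n)).1 ((hzeros _).2 ⟨n + 1, Nat.succ_pos n, rfl⟩).2
  have hall : ∀ w, diniEntire ν w = 0 → ∃ n, w = β n := by
    intro w hw
    obtain ⟨x, rfl⟩ : ∃ x : ℝ, w = x :=
      ⟨w.re, Complex.ext rfl (im_eq_zero_of_diniEntire_eq_zero hν hw)⟩
    have hx : 0 < x := by
      by_contra h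
      exact diniEntire_ne_zero_of_nonpos hν (not_lt.1 h) hw
    have hs := Real.sqrt_pos.2 hx
    have hd : diniC ν (Real.sqrt x) = 0 := by
      rw [diniC_ofReal_eq_zero_iff hν hs, Real.sq_sqrt hx.le, hw]
    obtain ⟨n, hn, hαn⟩ := (hzeros _).1 ⟨hs, hd⟩
    obtain ⟨m, rfl⟩ := Nat.exists_eq_add_of_le' hn
    refine ⟨m, ?_⟩
    simp only [hβdef, hαn, Real.sq_sqrt hx.le]
  have hunif : ∀ K : Set ℂ, IsCompact K → TendstoUniformlyOn
      (fun N w => ∏ n ∈ Finset.range N, (1 - w / (β n : ℂ))) (diniEntire ν) atTop K :=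
    fun K hK => tendstoUniformlyOn_partial_product (differentiable_diniEntire hν)
      (diniEntire_zero ν) hpos hβ hz
      (fun n => deriv_diniEntire_ne_zero hν (hpos n) (hz n)) hall
      (fun ε hε => realCoeffSeries_growth (isEntireCoeff_factorial_mul_diniCoeff hν) hε) hK
  have hprod := tprod_eq_of_tendsto (f := diniEntire ν) hpos fun w =>
    (hunif {w} isCompact_singleton).tendsto_at rfl
  have hβcast : ∀ n, ((β n : ℝ) : ℂ) = (α (n + 1) : ℂ) ^ 2 := fun n => by simp [hβdef]
  simp only [← hβcast, hprod]
  refine ⟨diniC_eq hν, fun K hK => ?_⟩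
  have hK2 : IsCompact ((fun z : ℂ => z ^ 2) '' K) := hK.image (by fun_prop)
  exact ((hunif _ hK2).comp (fun z : ℂ => z ^ 2)).mono (subset_preimage_image _ K)
end

section
/- If ν > −1 and x ∈ [0, α_{ν,1}), then d_ν(x) ≤ x^ν e^{−3x²/(4(ν+1))} / (2^ν Γ(ν+1)). -/
open Real Filter Set

/-- The Bessel function of the first kind of order `ν`, defined by its power series. -/
noncomputable def besselJ (ν x : ℝ) : ℝ :=
  ∑' n : ℕ, (-1 : ℝ) ^ n * x ^ (2 * (n : ℝ) + ν) /
    (2 ^ (2 * (n : ℝ) + ν) * (n.factorial : ℝ) * Real.Gamma ((n : ℝ) + ν + 1))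

/-- The Dini function `d_ν(x) = (1-ν) J_ν(x) + x J_ν'(x) = J_ν(x) - x J_{ν+1}(x)`. -/
noncomputable def dini (ν x : ℝ) : ℝ :=
  besselJ ν x - x * besselJ (ν + 1) x

/-- The normalised Bessel series `∑ (-t)^n / (n! Γ(n + a))`. -/
noncomputable def besselSeries (a t : ℝ) : ℝ :=
  ∑' n : ℕ, (-t) ^ n / ((n.factorial : ℝ) * Real.Gamma ((n : ℝ) + a))

lemma pow_mul_Gamma_le_Gamma_nat_add {a : ℝ} (ha : 0 < a) (n : ℕ) :
    a ^ n * Real.Gamma a ≤ Real.Gamma ((n : ℝ) + a) := by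
  induction n with
  | zero => simp
  | succ n ih =>
    have hn : 0 < (n : ℝ) + a := by positivity
    have e : ((n + 1 : ℕ) : ℝ) + a = ((n : ℝ) + a) + 1 := by push_cast; ring
    rw [e, Real.Gamma_add_one hn.ne', pow_succ, mul_comm (a ^ n) a, mul_assoc]
    have hΓ := Real.Gamma_pos_of_pos ha
    gcongr
    simp

lemma summable_pow_div_factorial_mul_Gamma {a : ℝ} (ha : 0 < a) (r : ℝ) :
    Summable fun n : ℕ => r ^ n / ((n.factorial : ℝ) * Real.Gamma ((n : ℝ) + a)) := by
  have hΓ := Real.Gamma_pos_of_pos ha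
  refine Summable.of_norm_bounded
    ((Real.summable_pow_div_factorial (|r| / a)).mul_right (Real.Gamma a)⁻¹) fun n => ?_
  have hn : 0 < Real.Gamma ((n : ℝ) + a) := Real.Gamma_pos_of_pos (by positivity)
  rw [Real.norm_eq_abs, abs_div, abs_pow,
    abs_of_pos (by positivity : 0 < (n.factorial : ℝ) * Real.Gamma ((n : ℝ) + a))]
  calc |r| ^ n / ((n.factorial : ℝ) * Real.Gamma ((n : ℝ) + a))
      ≤ |r| ^ n / ((n.factorial : ℝ) * (a ^ n * Real.Gamma a)) := by
        gcongr
        exact pow_mul_Gamma_le_Gamma_nat_add ha n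
    _ = _ := by rw [div_pow]; field_simp

lemma hasDerivAt_besselSeries {a : ℝ} (ha : 0 < a) (t : ℝ) :
    HasDerivAt (besselSeries a) (-besselSeries (a + 1) t) t := by
  set φ' : ℕ → ℝ → ℝ := fun n s =>
    ((n : ℝ) * (-s) ^ (n - 1) * (-1)) / ((n.factorial : ℝ) * Real.Gamma ((n : ℝ) + a)) with hφ'
  have shift (n : ℕ) (s : ℝ) : φ' (n + 1) s =
      -((-s) ^ n / ((n.factorial : ℝ) * Real.Gamma ((n : ℝ) + (a + 1)))) := by
    have hn : 0 < Real.Gamma ((n : ℝ) + (a + 1)) := Real.Gamma_pos_of_pos (by positivity)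
    have e : ((n + 1 : ℕ) : ℝ) + a = (n : ℝ) + (a + 1) := by push_cast; ring
    simp only [hφ', e, Nat.factorial_succ, Nat.add_sub_cancel]
    push_cast
    field_simp
  set R : ℝ := |t| + 1
  set u : ℕ → ℝ := fun n => |φ' n R|
  have hu : Summable u := by
    rw [← summable_nat_add_iff 1]
    refine Summable.abs ?_
    simp only [shift]
    exact (summable_pow_div_factorial_mul_Gamma (by positivity) _).neg
  have key := hasDerivAt_tsum_of_isPreconnected (t := Metric.ball (0 : ℝ) R) (y₀ := 0) (y := t)
    (g := fun (n : ℕ) s => (-s) ^ n / ((n.factorial : ℝ) * Real.Gamma ((n : ℝ) + a)))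
    (g' := φ') hu Metric.isOpen_ball (convex_ball _ _).isPreconnected
    (fun n s _ => (((hasDerivAt_id s).neg.pow n).div_const _))
    (fun n s hs => by
      have hs' : |s| ≤ |R| := by
        rw [mem_ball_zero_iff, Real.norm_eq_abs] at hs
        exact hs.le.trans (le_abs_self R)
      simp only [u, hφ', Real.norm_eq_abs, abs_div, abs_mul, abs_pow, abs_neg]
      gcongr)
    (Metric.mem_ball_self (by positivity))
    (summable_pow_div_factorial_mul_Gamma ha _)
    (by rw [mem_ball_zero_iff, Real.norm_eq_abs]; simp [R])
  have hsum : Summable fun n => φ' n t := by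
    rw [← summable_nat_add_iff 1]
    simp only [shift]
    exact (summable_pow_div_factorial_mul_Gamma (by positivity) _).neg
  rw [hsum.tsum_eq_zero_add] at key
  simp only [shift, tsum_neg] at key
  refine HasDerivAt.congr_deriv key ?_
  simp [hφ', besselSeries]

lemma besselSeries_zero (a : ℝ) : besselSeries a 0 = (Real.Gamma a)⁻¹ := by
  rw [besselSeries, tsum_eq_single 0]
  · simp
  · intro n hn
    simp [hn]

lemma mul_besselSeries_add_two {a : ℝ} (ha : 0 < a) (t : ℝ) :
    t * besselSeries (a + 1 + 1) t = a * besselSeries (a + 1) t - besselSeries a t := by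
  have h0 := summable_pow_div_factorial_mul_Gamma ha (-t)
  have h1 := summable_pow_div_factorial_mul_Gamma (show 0 < a + 1 by positivity) (-t)
  have h2 := (h1.mul_left a).sub h0
  simp only [besselSeries]
  rw [← tsum_mul_left, ← tsum_mul_left, ← (h1.mul_left a).tsum_sub h0, h2.tsum_eq_zero_add]
  have z : a * ((-t) ^ 0 / (((0 : ℕ).factorial : ℝ) * Real.Gamma (((0 : ℕ) : ℝ) + (a + 1)))) -
      (-t) ^ 0 / (((0 : ℕ).factorial : ℝ) * Real.Gamma (((0 : ℕ) : ℝ) + a)) = 0 := by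
    have hΓ := Real.Gamma_pos_of_pos ha
    simp only [Nat.cast_zero, zero_add, Real.Gamma_add_one ha.ne', pow_zero,
      Nat.factorial_zero, Nat.cast_one, one_mul]
    field_simp
    ring
  rw [z, zero_add]
  refine tsum_congr fun n => ?_
  have hp : 0 < (n : ℝ) + (a + 1) := by positivity
  have hΓ := Real.Gamma_pos_of_pos hp
  have e0 : ((n + 1 : ℕ) : ℝ) + a = (n : ℝ) + (a + 1) := by push_cast; ring
  have e1 : ((n + 1 : ℕ) : ℝ) + (a + 1) = (n : ℝ) + (a + 1) + 1 := by push_cast; ring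
  have e2 : (n : ℝ) + (a + 1 + 1) = (n : ℝ) + (a + 1) + 1 := by ring
  rw [e0, e1, e2, Real.Gamma_add_one hp.ne', Nat.factorial_succ]
  push_cast
  field_simp
  ring

/-- A differential inequality with a regular singular point at `0`: the function
`s ^ c * h s` is monotone, hence nonnegative. -/
lemma nonneg_of_mul_deriv_add_mul_nonneg {h h' : ℝ → ℝ} {c T : ℝ} (hc : 0 < c)
    (hd : ∀ s, HasDerivAt h (h' s) s)
    (hn : ∀ s ∈ Ioo 0 T, 0 ≤ s * h' s + c * h s) {s : ℝ} (hs : s ∈ Ioc 0 T) : 0 ≤ h s := by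
  have hmono : MonotoneOn (fun s => s ^ c * h s) (Icc 0 T) := by
    refine monotoneOn_of_hasDerivWithinAt_nonneg (convex_Icc _ _)
      (f' := fun s => c * s ^ (c - 1) * h s + s ^ c * h' s) ?_ ?_ ?_
    · have hcont : Continuous h := continuous_iff_continuousAt.2 fun s => (hd s).continuousAt
      exact ((Real.continuous_rpow_const hc.le).mul hcont).continuousOn
    · intro s hs
      rw [interior_Icc] at hs
      exact ((Real.hasDerivAt_rpow_const (Or.inl hs.1.ne')).mul (hd s)).hasDerivWithinAt
    · intro s hs
      rw [interior_Icc] at hs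
      have e : s ^ c = s ^ (c - 1) * s := by
        rw [Real.rpow_sub_one hs.1.ne', div_mul_cancel₀ _ hs.1.ne']
      have := mul_nonneg (Real.rpow_nonneg hs.1.le (c - 1)) (hn s hs)
      rw [e]
      linarith
  have := hmono (left_mem_Icc.2 (hs.1.le.trans hs.2)) (Ioc_subset_Icc_self hs) hs.1.le
  simp only [Real.zero_rpow hc.ne', zero_mul] at this
  exact nonneg_of_mul_nonneg_right this (Real.rpow_pos_of_pos hs.1 c)

/-- The normalised Dini function lies below its exponential majorant as long as it has no zero. -/
lemma besselSeries_sub_le_exp {a T : ℝ} (ha : 0 < a) (hT : 0 ≤ T)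
    (hF : ∀ s ∈ Icc 0 T, besselSeries a s - 2 * s * besselSeries (a + 1) s ≠ 0) :
    besselSeries a T - 2 * T * besselSeries (a + 1) T ≤ Real.exp (-(3 * T / a)) / Real.Gamma a := by
  have hΓ := Real.Gamma_pos_of_pos ha
  set G := besselSeries a
  set H := besselSeries (a + 1)
  set K := besselSeries (a + 1 + 1)
  have dG : ∀ s, HasDerivAt G (-H s) s := hasDerivAt_besselSeries ha
  have dH : ∀ s, HasDerivAt H (-K s) s := hasDerivAt_besselSeries (by positivity)
  have recurrence : ∀ s, s * K s = a * H s - G s := mul_besselSeries_add_two ha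
  have cG : Continuous G := continuous_iff_continuousAt.2 fun s => (dG s).continuousAt
  have cH : Continuous H := continuous_iff_continuousAt.2 fun s => (dH s).continuousAt
  have cF : Continuous fun s => G s - 2 * s * H s := by fun_prop
  have G0 : G 0 = (Real.Gamma a)⁻¹ := besselSeries_zero a
  have Fpos : ∀ s ∈ Icc 0 T, 0 < G s - 2 * s * H s := by
    intro s hs
    by_contra! hneg
    obtain ⟨y, hy, hy0⟩ := intermediate_value_Icc' hs.1 cF.continuousOn
      (show (0 : ℝ) ∈ Icc _ _ from ⟨hneg, by simp [G0, hΓ.le]⟩)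
    exact hF y ⟨hy.1, hy.2.trans hs.2⟩ hy0
  have H_nonneg_of : ∀ S, (∀ s ∈ Ioo 0 S, 0 ≤ G s) → ∀ s ∈ Ioc 0 S, 0 ≤ H s := by
    intro S hS s hs
    refine nonneg_of_mul_deriv_add_mul_nonneg ha dH (fun s hs => ?_) hs
    have := hS s hs
    linarith [recurrence s]
  have Gpos : ∀ s ∈ Icc 0 T, 0 < G s := by
    by_contra! hneg
    obtain ⟨s₁, hs₁, hG₁⟩ := hneg
    obtain ⟨s, ⟨hs, hGs⟩, hmin⟩ := (isCompact_Icc.inter_right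
      (isClosed_le cG continuous_const) : IsCompact (Icc 0 T ∩ {s | G s ≤ 0})).exists_isLeast
      ⟨s₁, hs₁, hG₁⟩
    have hs0 : 0 < s := by
      refine lt_of_le_of_ne hs.1 ?_
      rintro rfl
      have : 0 < G 0 := by rw [G0]; positivity
      exact absurd hGs (not_le.2 this)
    have hH : 0 ≤ H s := by
      refine H_nonneg_of s (fun y hy => ?_) s ⟨hs0, le_rfl⟩
      by_contra! hlt
      exact absurd (hmin ⟨⟨hy.1.le, hy.2.le.trans hs.2⟩, hlt.le⟩) (not_le.2 hy.2)
    have hGs' : G s ≤ 0 := hGs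
    have := Fpos s hs
    nlinarith [mul_nonneg hs0.le hH]
  have Hnonneg : ∀ s ∈ Ioc 0 T, 0 ≤ H s :=
    H_nonneg_of T fun s hs => (Gpos s (Ioo_subset_Icc_self hs)).le
  have G_le : ∀ s ∈ Ioc 0 T, 0 ≤ a * H s - G s := by
    intro s hs
    refine nonneg_of_mul_deriv_add_mul_nonneg ha
      (fun s => ((dH s).const_mul a).sub (dG s)) (fun s hs => ?_) hs
    have e : s * (a * -K s - -H s) + a * (a * H s - G s) = s * H s := by
      linear_combination (-a) * recurrence s
    refine (mul_nonneg hs.1.le (Hnonneg s (Ioo_subset_Ioc_self hs))).trans_eq e.symm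
  have two_mul_lt : ∀ s ∈ Ioc 0 T, 2 * s < a := by
    intro s hs
    have h1 := G_le s hs
    have h2 := Fpos s (Ioc_subset_Icc_self hs)
    have h3 := Hnonneg s hs
    by_contra! hle
    nlinarith [mul_le_mul_of_nonneg_right hle h3]
  have le_G : 9 / 2 ≤ a → ∀ s ∈ Ioc 0 T, 0 ≤ G s - a / 2 * H s := by
    intro ha' s hs
    refine nonneg_of_mul_deriv_add_mul_nonneg (half_pos ha)
      (fun s => (dG s).sub ((dH s).const_mul (a / 2))) (fun s hs => ?_) hs
    have e : s * (-H s - a / 2 * -K s) + a / 2 * (G s - a / 2 * H s)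
        = H s * (a ^ 2 / 4 - s) := by
      linear_combination (a / 2) * recurrence s
    have := two_mul_lt s (Ioo_subset_Ioc_self hs)
    exact (mul_nonneg (Hnonneg s (Ioo_subset_Ioc_self hs)) (by nlinarith)).trans_eq e.symm
  have comb_nonneg : ∀ s ∈ Ioc 0 T, 0 ≤ 6 * G s - (2 * a - 9) * H s := by
    intro s hs
    have h1 := Gpos s (Ioc_subset_Icc_self hs)
    have h2 := Hnonneg s hs
    rcases le_total (9 / 2) a with h | h
    · have := le_G h s hs
      nlinarith [mul_nonneg ha.le h2]
    · nlinarith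
  have P_nonneg : ∀ s ∈ Ioc 0 T, 0 ≤ (2 * a - 3) * (G s - a * H s) + 6 * s * H s := by
    intro s hs
    refine nonneg_of_mul_deriv_add_mul_nonneg ha
      (fun s => (((dG s).sub ((dH s).const_mul a)).const_mul (2 * a - 3)).add
        (((hasDerivAt_id s).const_mul 6).mul (dH s))) (fun s hs => ?_) hs
    have := mul_nonneg hs.1.le (comb_nonneg s (Ioo_subset_Ioc_self hs))
    simp only [id, Pi.add_apply, Pi.sub_apply, Pi.mul_apply]
    refine this.trans_eq ?_
    linear_combination (-(2 * a - 3) * a + 6 * s) * recurrence s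
  have anti : AntitoneOn (fun s => Real.exp (3 * s / a) * (G s - 2 * s * H s)) (Icc 0 T) := by
    refine antitoneOn_of_hasDerivWithinAt_nonpos (convex_Icc _ _)
      (f' := fun s => -(Real.exp (3 * s / a) *
        ((2 * a - 3) * (G s - a * H s) + 6 * s * H s) / a)) ?_ ?_ ?_
    · fun_prop
    · intro s hs
      have d := ((((hasDerivAt_id s).const_mul 3).div_const a).exp.mul
        ((dG s).sub (((hasDerivAt_id s).const_mul 2).mul (dH s)))).hasDerivWithinAt
          (s := interior (Icc 0 T))
      refine d.congr_deriv ?_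
      simp only [id, Pi.sub_apply, Pi.mul_apply]
      field_simp
      linear_combination (2 * a) * recurrence s
    · intro s hs
      rw [interior_Icc] at hs
      have := P_nonneg s (Ioo_subset_Ioc_self hs)
      have : 0 ≤ Real.exp (3 * s / a) *
        ((2 * a - 3) * (G s - a * H s) + 6 * s * H s) / a := by positivity
      linarith
  have h := anti (left_mem_Icc.2 hT) (right_mem_Icc.2 hT) hT
  simp only [mul_zero, zero_div, Real.exp_zero, G0, zero_mul, sub_zero, one_mul] at h
  rw [Real.exp_neg, div_eq_mul_inv, ← div_eq_inv_mul, le_div_iff₀ (Real.exp_pos _), mul_comm]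
  exact h

lemma besselJ_eq {ν x : ℝ} (hν : -1 < ν) (hx : 0 ≤ x) :
    besselJ ν x = x ^ ν / 2 ^ ν * besselSeries (ν + 1) (x ^ 2 / 4) := by
  rw [besselJ, besselSeries, ← tsum_mul_left]
  refine tsum_congr fun n => ?_
  have hxn : x ^ (2 * (n : ℝ) + ν) = x ^ ν * (x ^ 2) ^ n := by
    rcases hx.eq_or_lt with rfl | hx
    · rcases Nat.eq_zero_or_pos n with rfl | hn
      · simp
      · have : (1 : ℝ) ≤ n := by exact_mod_cast hn
        rw [Real.zero_rpow (by linarith)]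
        simp [hn.ne']
    · rw [add_comm, Real.rpow_add hx, ← pow_mul]
      norm_cast
  have h2n : (2 : ℝ) ^ (2 * (n : ℝ) + ν) = 2 ^ ν * 4 ^ n := by
    rw [add_comm, Real.rpow_add two_pos, show (4 : ℝ) = 2 ^ 2 by norm_num, ← pow_mul]
    norm_cast
  have hΓ : 0 < Real.Gamma ((n : ℝ) + ν + 1) :=
    Real.Gamma_pos_of_pos (by have := n.cast_nonneg (α := ℝ); linarith)
  rw [hxn, h2n, ← add_assoc, neg_pow (x ^ 2 / 4), div_pow]
  field_simp

lemma dini_eq {ν x : ℝ} (hν : -1 < ν) (hx : 0 ≤ x) :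
    dini ν x = x ^ ν / 2 ^ ν * (besselSeries (ν + 1) (x ^ 2 / 4) -
      2 * (x ^ 2 / 4) * besselSeries (ν + 1 + 1) (x ^ 2 / 4)) := by
  rw [dini, besselJ_eq hν hx, besselJ_eq (by linarith) hx]
  rcases hx.eq_or_lt with rfl | hx
  · simp
  · rw [Real.rpow_add_one hx.ne', Real.rpow_add_one two_ne_zero]
    field_simp
    ring

/-- If `ν > -1`, `a1 = α_{ν,1}` is the first positive zero of the Dini
function `d_ν`, and `x ∈ [0, a1)`, then
`d_ν(x) ≤ x^ν e^{-3x²/(4(ν+1))} / (2^ν Γ(ν+1))`. -/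
theorem dini_upper_bound (ν : ℝ) (hν : -1 < ν)
    (a1 : ℝ) (ha1pos : 0 < a1) (ha1zero : dini ν a1 = 0)
    (ha1min : ∀ y : ℝ, 0 < y → dini ν y = 0 → a1 ≤ y)
    (x : ℝ) (hx : x ∈ Set.Ico (0 : ℝ) a1) :
    dini ν x ≤ x ^ ν * Real.exp (-(3 * x ^ 2) / (4 * (ν + 1))) /
      (2 ^ ν * Real.Gamma (ν + 1)) := by
  have ha : 0 < ν + 1 := by linarith
  have hF : ∀ s ∈ Icc 0 (x ^ 2 / 4),
      besselSeries (ν + 1) s - 2 * s * besselSeries (ν + 1 + 1) s ≠ 0 := by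
    intro s hs h0
    rcases hs.1.eq_or_lt with rfl | hs0
    · have := Real.Gamma_pos_of_pos ha
      simp [besselSeries_zero, this.ne'] at h0
    · have hy : (2 * √s) ^ 2 / 4 = s := by
        rw [mul_pow, Real.sq_sqrt hs.1]
        ring
      have hle := ha1min (2 * √s) (by positivity) (by
        rw [dini_eq hν (by positivity), hy, h0, mul_zero])
      have hyx : 2 * √s ≤ x := by
        refine le_of_sq_le_sq ?_ hx.1
        linarith [hs.2]
      linarith [hx.2]
  have key := besselSeries_sub_le_exp ha (by positivity) hF
  rw [dini_eq hν hx.1]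
  have hpos : 0 ≤ x ^ ν / 2 ^ ν := div_nonneg (Real.rpow_nonneg hx.1 _) (by positivity)
  refine (mul_le_mul_of_nonneg_left key hpos).trans_eq ?_
  rw [show -(3 * (x ^ 2 / 4) / (ν + 1)) = -(3 * x ^ 2) / (4 * (ν + 1)) by field_simp,
    div_mul_div_comm]
end
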